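/- In St ⊗_k St the following identities hold: for all x, y ∈ F, all t ∈ F* and all z ∈ F, h(t)·ω_{x,y} = ω_{t²x, t²y} and ε(z)·ω_{x,y} = ω_{z+x, z+y}; moreover s·ω_{0,0} = ω_{0,0}, and for all x, y ∈ F* one has s·ω_{x,y} = ω_{−x^{-1}, −y^{-1}} − ω_{−x^{-1}, 0} − ω_{−y^{-1}, 0} + ω_{0,0} and s·ω_{x,0} = −ω_{−x^{-1}, 0} + ω_{0,0}. -/

import Mathlib

noncomputable section

open scoped TensorProduct

namespace SL2X

variable (p : ℕ) [Fact p.Prime]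

/-- The algebraic closure of the prime field `𝔽_p`. -/
abbrev F : Type := AlgebraicClosure (ZMod p)

/-- `G = SL₂(F)`. -/
abbrev G : Type := Matrix.SpecialLinearGroup (Fin 2) (F p)

/-- The unipotent element `ε(x) = [[1,x],[0,1]]`. -/
def eps (x : F p) : G p :=
  ⟨!![1, x; 0, 1], by simp [Matrix.det_fin_two_of]⟩

/-- The torus element `h(t) = diag(t, t⁻¹)`. -/
def h (t : (F p)ˣ) : G p :=
  ⟨!![(t : F p), 0; 0, ((t⁻¹ : (F p)ˣ) : F p)], by simp [Matrix.det_fin_two_of]⟩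

/-- The Weyl element `s = [[0,1],[-1,0]]`. -/
def sG : G p :=
  ⟨!![0, 1; -1, 0], by simp [Matrix.det_fin_two_of]⟩

/-- The Borel subgroup `B` of upper triangular matrices in `G`. -/
def B : Subgroup (G p) where
  carrier := {g | (g : Matrix (Fin 2) (Fin 2) (F p)) 1 0 = 0}
  one_mem' := by simp [Matrix.one_apply]
  mul_mem' := by
    intro a b ha hb
    simp only [Set.mem_setOf_eq] at *
    simp [Matrix.mul_apply, Fin.sum_univ_two, ha, hb]
  inv_mem' := by
    intro a ha
    simp only [Set.mem_setOf_eq] at *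
    simp [Matrix.SpecialLinearGroup.coe_inv, Matrix.adjugate_fin_two, ha]

/-- The diagonal part of an element of `B`, as a unit of `F`. -/
def Bdiag (b : B p) : (F p)ˣ where
  val := ((b : G p) : Matrix (Fin 2) (Fin 2) (F p)) 0 0
  inv := ((b : G p) : Matrix (Fin 2) (Fin 2) (F p)) 1 1
  val_inv := by
    have hdet : ((b : G p) : Matrix (Fin 2) (Fin 2) (F p)).det = 1 := (b : G p).2
    have h10 : ((b : G p) : Matrix (Fin 2) (Fin 2) (F p)) 1 0 = 0 := b.2
    rw [Matrix.det_fin_two, h10, mul_zero, sub_zero] at hdet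
    exact hdet
  inv_val := by
    have hdet : ((b : G p) : Matrix (Fin 2) (Fin 2) (F p)).det = 1 := (b : G p).2
    have h10 : ((b : G p) : Matrix (Fin 2) (Fin 2) (F p)) 1 0 = 0 := b.2
    rw [Matrix.det_fin_two, h10, mul_zero, sub_zero] at hdet
    rw [mul_comm]; exact hdet

variable (k : Type) [Field k] [IsAlgClosed k] [CharZero k]

/-- The group algebra `kG`. -/
abbrev kG : Type := MonoidAlgebra k (G p)

/-- The canonical image of a group element in the group algebra. -/
def γ (g : G p) : kG p k := MonoidAlgebra.of k (G p) g

/-- The submodule of relations defining the induced module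
`M(θ) = kG ⊗_{kB} k_θ`, where the character `θ` of `T ≅ Fˣ` is extended to `B`
by letting `U` act trivially. -/
def Nmod (θ : (F p)ˣ →* kˣ) : Submodule (kG p k) (kG p k) :=
  Submodule.span (kG p k)
    {y | ∃ b : B p, y = γ p k (b : G p) - ((θ (Bdiag p b) : k)) • (1 : kG p k)}

/-- The induced module `M(θ) = kG ⊗_{kB} k_θ`, realized as `kG / N(θ)` where
`N(θ)` is the left submodule generated by the elements `b - θ(b)·1`, `b ∈ B`. -/
def Mmod (θ : (F p)ˣ →* kˣ) : Type := kG p k ⧸ Nmod p k θ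

instance (θ : (F p)ˣ →* kˣ) : AddCommGroup (Mmod p k θ) :=
  inferInstanceAs (AddCommGroup (kG p k ⧸ Nmod p k θ))
instance (θ : (F p)ˣ →* kˣ) : Module (kG p k) (Mmod p k θ) :=
  inferInstanceAs (Module (kG p k) (kG p k ⧸ Nmod p k θ))
instance (θ : (F p)ˣ →* kˣ) : Module k (Mmod p k θ) :=
  inferInstanceAs (Module k (kG p k ⧸ Nmod p k θ))
instance (θ : (F p)ˣ →* kˣ) : IsScalarTower k (kG p k) (Mmod p k θ) :=
  inferInstanceAs (IsScalarTower k (kG p k) (kG p k ⧸ Nmod p k θ))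

/-- The canonical generator `1_θ ∈ M(θ)`. -/
def oneθ (θ : (F p)ˣ →* kˣ) : Mmod p k θ :=
  Submodule.Quotient.mk (1 : kG p k)

/-- `η = (1 - s)·1_tr ∈ M(tr)`. -/
def eta : Mmod p k 1 :=
  Submodule.Quotient.mk ((1 : kG p k) - γ p k (sG p))

/-- The Steinberg module `St = kG·η ⊆ M(tr)`. -/
def St : Submodule (kG p k) (Mmod p k 1) :=
  Submodule.span (kG p k) {eta p k}

/-- `ε(x)·η` as an element of `St`. -/
def E (x : F p) : ↥(St p k) :=
  ⟨γ p k (eps p x) • eta p k,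
    Submodule.smul_mem _ _ (Submodule.mem_span_singleton_self _)⟩

/-- The action of a group element on `St`, as a `k`-linear map. -/
def gSt (g : G p) : ↥(St p k) →ₗ[k] ↥(St p k) where
  toFun v := ⟨γ p k g • (v : Mmod p k 1), Submodule.smul_mem _ _ v.2⟩
  map_add' := by intro a b; apply Subtype.ext; simp [smul_add]
  map_smul' := by
    intro c v; apply Subtype.ext
    simp [smul_comm (γ p k g) c]

/-- `St ⊗_k St`. -/
abbrev StT : Type := ↥(St p k) ⊗[k] ↥(St p k)

/-- The diagonal action of a group element on `St ⊗_k St`. -/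
def gTT (g : G p) : StT p k →ₗ[k] StT p k :=
  TensorProduct.map (gSt p k g) (gSt p k g)

/-- `ω_{x,y} = (ε(x)η ⊗ ε(y)η + ε(y)η ⊗ ε(x)η)/2`. -/
def ω (x y : F p) : StT p k :=
  (2 : k)⁻¹ • (E p k x ⊗ₜ[k] E p k y + E p k y ⊗ₜ[k] E p k x)

/-- `ρ_{x,y} = (ε(x)η ⊗ ε(y)η − ε(y)η ⊗ ε(x)η)/2`. -/
def ρ (x y : F p) : StT p k :=
  (2 : k)⁻¹ • (E p k x ⊗ₜ[k] E p k y - E p k y ⊗ₜ[k] E p k x)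

/-- `V₊`, the span of the `ω_{x,y}`. -/
def Vplus : Submodule k (StT p k) :=
  Submodule.span k {v | ∃ x y : F p, v = ω p k x y}

/-- `V₋`, the span of the `ρ_{x,y}` for `x ≠ y`. -/
def Vminus : Submodule k (StT p k) :=
  Submodule.span k {v | ∃ x y : F p, x ≠ y ∧ v = ρ p k x y}


theorem coe_eps (x : F p) : (eps p x : Matrix (Fin 2) (Fin 2) (F p)) = !![1, x; 0, 1] := rfl

theorem coe_h (t : (F p)ˣ) :
    (h p t : Matrix (Fin 2) (Fin 2) (F p)) = !![(t : F p), 0; 0, ((t⁻¹ : (F p)ˣ) : F p)] := rfl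

theorem coe_sG : (sG p : Matrix (Fin 2) (Fin 2) (F p)) = !![0, 1; -1, 0] := rfl

/-- The class of a group element `g` in `M(tr)`, that is `g·1_tr`. -/
def cosetVec (g : G p) : Mmod p k 1 := Submodule.Quotient.mk (γ p k g)

theorem γ_smul_cosetVec (g a : G p) :
    γ p k g • cosetVec p k a = cosetVec p k (g * a) := by
  have hγ : γ p k (g * a) = γ p k g • γ p k a := map_mul (MonoidAlgebra.of k (G p)) g a
  unfold cosetVec
  rw [hγ]
  rfl

theorem cosetVec_mul_of_mem_B (g : G p) (b : B p) :
    cosetVec p k (g * b) = cosetVec p k g := by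
  refine (Submodule.Quotient.eq (Nmod p k 1)).2 ?_
  have hb : γ p k (b : G p) - ((((1 : (F p)ˣ →* kˣ) (Bdiag p b) : kˣ) : k)) • (1 : kG p k)
      ∈ Nmod p k 1 := Submodule.subset_span ⟨b, rfl⟩
  have hg := Submodule.smul_mem _ (γ p k g) hb
  have hγ : γ p k (g * b) = γ p k g * γ p k b := map_mul (MonoidAlgebra.of k (G p)) g b
  rw [hγ]
  simpa [mul_sub] using hg

/-- `g·1_tr` depends only on the first column of `g` up to scalars. -/
theorem cosetVec_eq (a b : G p)
    (hab : (a : Matrix (Fin 2) (Fin 2) (F p)) 0 0 * (b : Matrix (Fin 2) (Fin 2) (F p)) 1 0 =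
      (a : Matrix (Fin 2) (Fin 2) (F p)) 1 0 * (b : Matrix (Fin 2) (Fin 2) (F p)) 0 0) :
    cosetVec p k a = cosetVec p k b := by
  have hmem : a⁻¹ * b ∈ B p := by
    change ((a⁻¹ * b : G p) : Matrix (Fin 2) (Fin 2) (F p)) 1 0 = 0
    simp [Matrix.SpecialLinearGroup.coe_inv, Matrix.adjugate_fin_two, Matrix.mul_apply,
      Fin.sum_univ_two, hab]
  have := cosetVec_mul_of_mem_B p k a ⟨a⁻¹ * b, hmem⟩
  simpa using this.symm

theorem eta_eq : eta p k = cosetVec p k 1 - cosetVec p k (sG p) := by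
  have h1 : γ p k (1 : G p) = 1 := map_one (MonoidAlgebra.of k (G p))
  unfold cosetVec
  rw [h1]
  rfl

theorem γ_smul_eta (g : G p) :
    γ p k g • eta p k = cosetVec p k g - cosetVec p k (g * sG p) := by
  rw [eta_eq, smul_sub, γ_smul_cosetVec, γ_smul_cosetVec, mul_one]

theorem coe_E (x : F p) :
    (E p k x : Mmod p k 1) = cosetVec p k (eps p x) - cosetVec p k (eps p x * sG p) :=
  γ_smul_eta p k _

theorem coe_gSt_E (g : G p) (x : F p) :
    (gSt p k g (E p k x) : Mmod p k 1) =
      cosetVec p k (g * eps p x) - cosetVec p k (g * (eps p x * sG p)) := by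
  change γ p k g • (E p k x : Mmod p k 1) = _
  rw [coe_E, smul_sub, γ_smul_cosetVec, γ_smul_cosetVec]

theorem gSt_h_E (t : (F p)ˣ) (x : F p) :
    gSt p k (h p t) (E p k x) = E p k ((t : F p) ^ 2 * x) := by
  apply Subtype.ext
  rw [coe_gSt_E, coe_E]
  congr 1 <;> apply cosetVec_eq <;>
    simp [coe_h, coe_eps, coe_sG]
  field_simp

theorem gSt_eps_E (z x : F p) :
    gSt p k (eps p z) (E p k x) = E p k (z + x) := by
  apply Subtype.ext
  rw [coe_gSt_E, coe_E]
  congr 1 <;> apply cosetVec_eq <;>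
    simp [coe_eps, coe_sG]

theorem gSt_s_E_zero : gSt p k (sG p) (E p k 0) = -E p k 0 := by
  apply Subtype.ext
  rw [coe_gSt_E, Submodule.coe_neg, coe_E, neg_sub]
  congr 1 <;> apply cosetVec_eq <;>
    simp [coe_eps, coe_sG]

theorem gSt_s_E {x : F p} (hx : x ≠ 0) :
    gSt p k (sG p) (E p k x) = E p k (-x⁻¹) - E p k 0 := by
  apply Subtype.ext
  rw [coe_gSt_E, AddSubgroupClass.coe_sub, coe_E, coe_E]
  have h1 : cosetVec p k (eps p (-x⁻¹)) = cosetVec p k (eps p 0) := by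
    apply cosetVec_eq
    simp [coe_eps]
  have h2 : cosetVec p k (sG p * eps p x) = cosetVec p k (eps p 0 * sG p) := by
    apply cosetVec_eq
    simp [coe_eps, coe_sG]
  have h3 : cosetVec p k (sG p * (eps p x * sG p)) = cosetVec p k (eps p (-x⁻¹) * sG p) := by
    apply cosetVec_eq
    simp [coe_eps, coe_sG, hx]
  rw [h1, h2, h3]
  abel

theorem gTT_ω (g : G p) (x y : F p) :
    gTT p k g (ω p k x y) = (2 : k)⁻¹ •
      (gSt p k g (E p k x) ⊗ₜ[k] gSt p k g (E p k y) +
        gSt p k g (E p k y) ⊗ₜ[k] gSt p k g (E p k x)) := by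
  simp only [gTT, ω, map_smul, map_add, TensorProduct.map_tmul]

/-- the action of `h(t)`, `ε(z)` and `s` on the elements `ω_{x,y}`. -/
theorem stmt2 (hp2 : p ≠ 2) :
    (∀ (x y : F p) (t : (F p)ˣ),
      gTT p k (h p t) (ω p k x y) = ω p k ((t : F p) ^ 2 * x) ((t : F p) ^ 2 * y)) ∧
    (∀ (x y z : F p),
      gTT p k (eps p z) (ω p k x y) = ω p k (z + x) (z + y)) ∧
    gTT p k (sG p) (ω p k 0 0) = ω p k 0 0 ∧
    (∀ x y : F p, x ≠ 0 → y ≠ 0 →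
      gTT p k (sG p) (ω p k x y) =
        ω p k (-x⁻¹) (-y⁻¹) - ω p k (-x⁻¹) 0 - ω p k (-y⁻¹) 0 + ω p k 0 0) ∧
    (∀ x : F p, x ≠ 0 →
      gTT p k (sG p) (ω p k x 0) = -ω p k (-x⁻¹) 0 + ω p k 0 0) := by
  refine ⟨fun x y t => ?_, fun x y z => ?_, ?_, fun x y hx hy => ?_, fun x hx => ?_⟩
  · rw [gTT_ω, gSt_h_E, gSt_h_E, ω]
  · rw [gTT_ω, gSt_eps_E, gSt_eps_E, ω]
  · rw [gTT_ω, gSt_s_E_zero, ω, TensorProduct.neg_tmul, TensorProduct.tmul_neg]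
    module
  · rw [gTT_ω, gSt_s_E p k hx, gSt_s_E p k hy]
    simp only [ω, TensorProduct.sub_tmul, TensorProduct.tmul_sub]
    module
  · rw [gTT_ω, gSt_s_E p k hx, gSt_s_E_zero]
    simp only [ω, TensorProduct.sub_tmul, TensorProduct.tmul_sub, TensorProduct.neg_tmul,
      TensorProduct.tmul_neg]
    module

end SL2X
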